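/- Let (u, θ) be a smooth solution of the thermoelastic system. Then for every t > 0, (1/2) d/dt (∫_Ω (div u_t)² dx + ∫_Ω |curl u_t|² dx + (2μ+λ)∫_Ω |∇(div u)|² dx + μ∫_Ω |curl curl u|² dx) = −ν ∫_Ω Δθ div(u_t) dx. -/

import Mathlib

open MeasureTheory Real Filter Set
open scoped Topology

noncomputable section

/-- Euclidean space `ℝ^d`. -/
abbrev Ed (d : ℕ) := EuclideanSpace ℝ (Fin d)

/-- Partial derivative of a scalar function in the `i`-th coordinate direction. -/
def pd {d : ℕ} (i : Fin d) (f : Ed d → ℝ) (x : Ed d) : ℝ :=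
  fderiv ℝ f x (EuclideanSpace.single i 1)

/-- Divergence of a vector field. -/
def divg {d : ℕ} (w : Ed d → Ed d) (x : Ed d) : ℝ :=
  ∑ i, pd i (fun y => w y i) x

/-- Laplacian of a scalar function. -/
def lap {d : ℕ} (f : Ed d → ℝ) (x : Ed d) : ℝ :=
  ∑ i, pd i (fun y => pd i f y) x

/-- Squared euclidean norm of the gradient of a scalar function. -/
def gradNormSq {d : ℕ} (f : Ed d → ℝ) (x : Ed d) : ℝ :=
  ∑ i, (pd i f x) ^ 2

/-- Squared Frobenius norm of the Hessian of a scalar function. -/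
def hessNormSq {d : ℕ} (f : Ed d → ℝ) (x : Ed d) : ℝ :=
  ∑ i, ∑ j, (pd i (fun y => pd j f y) x) ^ 2

/-- The antisymmetric curl two-form `(curl w)ᵢⱼ = ∂ᵢ wⱼ - ∂ⱼ wᵢ`. -/
def curlM {d : ℕ} (w : Ed d → Ed d) (x : Ed d) (i j : Fin d) : ℝ :=
  pd i (fun y => w y j) x - pd j (fun y => w y i) x

/-- `|curl w|²`: in dimension 2 (scalar curl) and 3 (vector curl) this equals
the squared norm of the curl. -/
def curlNormSq {d : ℕ} (w : Ed d → Ed d) (x : Ed d) : ℝ :=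
  (1 / 2) * ∑ i, ∑ j, (curlM w x i j) ^ 2

/-- `j`-th component of `curl curl w` (in dimensions 2 and 3 this is
`∑ i ∂ᵢ (∂ⱼ wᵢ - ∂ᵢ wⱼ) = ∂ⱼ (div w) - Δ wⱼ`). -/
def ccurl {d : ℕ} (w : Ed d → Ed d) (x : Ed d) (j : Fin d) : ℝ :=
  ∑ i, pd i (fun y => curlM w y j i) x

/-- `j`-th component of the componentwise Laplacian of a vector field. -/
def veclap {d : ℕ} (w : Ed d → Ed d) (x : Ed d) (j : Fin d) : ℝ :=
  ∑ i, pd i (fun y => pd i (fun z => w z j) y) x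

/-- Time derivative of a time-dependent field. -/
def tder {α : Type*} {F : Type*} [NormedAddCommGroup F] [NormedSpace ℝ F]
    (u : ℝ → α → F) : ℝ → α → F :=
  fun t x => deriv (fun s => u s x) t

/-- An open, bounded, convex domain in `ℝ^d` (`d ∈ {2,3}`) together with its outward
unit normal field `n` on the boundary.  For a convex body with smooth boundary the
outward unit normal at a boundary point is characterized by the supporting
half-space inequality. -/
structure GoodDomain (d : ℕ) (Ω : Set (Ed d)) (n : Ed d → Ed d) : Prop where
  dims : d = 2 ∨ d = 3
  isOpen : IsOpen Ω
  bounded : Bornology.IsBounded Ω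
  convex : Convex ℝ Ω
  nonempty : Ω.Nonempty
  normal_unit : ∀ x ∈ frontier Ω, ‖n x‖ = 1
  normal_outward : ∀ x ∈ frontier Ω, ∀ y ∈ closure Ω, ∑ i, (y i - x i) * n x i ≤ 0

/-- A smooth solution `(u, θ)` of the thermoelastic system
`u_tt - (2μ+λ)∇(div u) + μ curl curl u = -ν∇θ`, `θ_t - Δθ = -ν θ div u_t`
with boundary conditions `u·n = 0`, `𝒩u = 0` (encoded as `(curl u) n = 0`,
which in dimension 2 means `curl u = 0` and in dimension 3 means
`curl u × n = 0`) and `∇θ·n = 0`, and with positive temperature. -/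
structure IsSolution {d : ℕ} (Ω : Set (Ed d)) (n : Ed d → Ed d)
    (μ lam ν : ℝ) (u : ℝ → Ed d → Ed d) (θ : ℝ → Ed d → ℝ) : Prop where
  smooth_u : ContDiff ℝ (⊤ : ℕ∞) (fun p : ℝ × Ed d => u p.1 p.2)
  smooth_θ : ContDiff ℝ (⊤ : ℕ∞) (fun p : ℝ × Ed d => θ p.1 p.2)
  theta_pos : ∀ t : ℝ, 0 ≤ t → ∀ x ∈ closure Ω, 0 < θ t x
  wave : ∀ t : ℝ, 0 < t → ∀ x ∈ Ω, ∀ j : Fin d,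
    tder (tder u) t x j - (2 * μ + lam) * pd j (divg (u t)) x
      + μ * ccurl (u t) x j = -ν * pd j (θ t) x
  heat : ∀ t : ℝ, 0 < t → ∀ x ∈ Ω,
    tder θ t x - lap (θ t) x = -ν * θ t x * divg (tder u t) x
  bc_u : ∀ t : ℝ, 0 < t → ∀ x ∈ frontier Ω, ∑ i, u t x i * n x i = 0
  bc_N : ∀ t : ℝ, 0 < t → ∀ x ∈ frontier Ω, ∀ i : Fin d,
    ∑ j, curlM (u t) x i j * n x j = 0
  bc_θ : ∀ t : ℝ, 0 < t → ∀ x ∈ frontier Ω, ∑ i, pd i (θ t) x * n x i = 0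

/-- The functional `F(u, u_t, θ)` built from the Fisher information and
higher-order derivatives of the displacement. -/
def Ffun {d : ℕ} (Ω : Set (Ed d)) (μ lam : ℝ)
    (u : ℝ → Ed d → Ed d) (θ : ℝ → Ed d → ℝ) (t : ℝ) : ℝ :=
  (1 / 2) * ((∫ x in Ω, (divg (tder u t) x) ^ 2)
    + (∫ x in Ω, curlNormSq (tder u t) x)
    + (2 * μ + lam) * (∫ x in Ω, gradNormSq (divg (u t)) x)
    + μ * (∫ x in Ω, ∑ j, (ccurl (u t) x j) ^ 2)
    + (∫ x in Ω, gradNormSq (θ t) x / θ t x))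

/-- The small-data condition
`‖div v₀‖² + ‖curl v₀‖² + (2μ+λ)‖∇div u₀‖² + μ‖curl curl u₀‖² + ‖∇θ₀/√θ₀‖² ≤ D`. -/
def smallData {d : ℕ} (Ω : Set (Ed d)) (μ lam : ℝ)
    (u0 v0 : Ed d → Ed d) (θ0 : Ed d → ℝ) (D : ℝ) : Prop :=
  (∫ x in Ω, (divg v0 x) ^ 2) + (∫ x in Ω, curlNormSq v0 x)
    + (2 * μ + lam) * (∫ x in Ω, gradNormSq (divg u0) x)
    + μ * (∫ x in Ω, ∑ j, (ccurl u0 x j) ^ 2)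
    + (∫ x in Ω, gradNormSq θ0 x / θ0 x) ≤ D

/-- The norm `‖w‖_H = (‖div w‖² + ‖curl w‖²)^{1/2}`. -/
def Hnorm {d : ℕ} (Ω : Set (Ed d)) (w : Ed d → Ed d) : ℝ :=
  Real.sqrt ((∫ x in Ω, (divg w x) ^ 2) + (∫ x in Ω, curlNormSq w x))

end

/-- A supporting inequality for the distance to the complement. -/
theorem infDist_compl_le_of_support {E : Type*} [NormedAddCommGroup E] [InnerProductSpace ℝ E]
    {Ω : Set E} {y m : E} (hm : ‖m‖ = 1)
    (hsupp : ∀ z ∈ Ω, inner ℝ (z - y) m ≤ 0) {z : E} (hz : z ∈ Ω) :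
    Metric.infDist z Ωᶜ ≤ inner ℝ (y - z) m := by
  refine le_of_forall_lt fun ρ hρ => lt_of_not_ge fun hle => ?_
  obtain ⟨r, hρr, hr⟩ := exists_between hρ
  by_cases hr0 : r < 0
  · have h1 := hsupp z hz
    have h2 : inner ℝ (y - z) m = - inner ℝ (z - y) m := by rw [← inner_neg_left, neg_sub]
    linarith
  · push Not at hr0
    have hmem : z + r • m ∈ Ω := by
      refine Metric.ball_infDist_compl_subset (x := z) ?_
      simpa [Metric.mem_ball, dist_eq_norm, norm_smul, hm, abs_of_nonneg hr0] using hr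
    have h1 := hsupp _ hmem
    have h2 : inner ℝ (z + r • m - y) m = r - inner ℝ (y - z) m := by
      have : z + r • m - y = r • m - (y - z) := by abel
      rw [this, inner_sub_left, real_inner_smul_left, real_inner_self_eq_norm_sq, hm]
      ring
    linarith

/-- A nearest point of the complement of an open set lies on the frontier. -/
theorem exists_frontier_dist_eq_infDist_compl {E : Type*} [NormedAddCommGroup E]
    [NormedSpace ℝ E] [ProperSpace E] {Ω : Set E} (ho : IsOpen Ω) (hne : Ωᶜ.Nonempty)
    {x : E} (hx : x ∈ Ω) :
    ∃ y ∈ frontier Ω, Metric.infDist x Ωᶜ = dist x y := by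
  obtain ⟨y, hy, hxy⟩ := ho.isClosed_compl.exists_infDist_eq_dist hne x
  refine ⟨y, ?_, hxy⟩
  rw [ho.frontier_eq]
  refine ⟨?_, hy⟩
  have hpos : dist x y ≠ 0 := by
    rw [dist_ne_zero]
    rintro rfl
    exact hy hx
  refine closure_mono (Metric.ball_infDist_compl_subset (x := x)) ?_
  rw [hxy, closure_ball x hpos, Metric.mem_closedBall, dist_comm]

/-- The cutoff function `min 1 (dist(·, Ωᶜ) / ε)`. -/
noncomputable def distCutoff {E : Type*} [PseudoMetricSpace E] (Ω : Set E) (ε : ℝ) (x : E) : ℝ :=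
  min 1 (ε⁻¹ * Metric.infDist x Ωᶜ)

theorem lipschitzWith_distCutoff {E : Type*} [PseudoMetricSpace E] (Ω : Set E) (ε : ℝ) :
    LipschitzWith ‖ε⁻¹‖₊ (distCutoff Ω ε) := by
  have h := ((lipschitzWith_smul (α := ℝ) (β := ℝ) ε⁻¹).comp
    (Metric.lipschitz_infDist_pt Ωᶜ)).const_min 1
  rw [mul_one] at h
  exact h

theorem distCutoff_nonneg {E : Type*} [PseudoMetricSpace E] (Ω : Set E) {ε : ℝ} (hε : 0 < ε)
    (x : E) : 0 ≤ distCutoff Ω ε x :=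
  le_min zero_le_one (mul_nonneg (inv_nonneg.2 hε.le) Metric.infDist_nonneg)

theorem distCutoff_le_one {E : Type*} [PseudoMetricSpace E] (Ω : Set E) (ε : ℝ)
    (x : E) : distCutoff Ω ε x ≤ 1 := min_le_left _ _

theorem distCutoff_of_notMem {E : Type*} [PseudoMetricSpace E] {Ω : Set E} (ε : ℝ)
    {x : E} (hx : x ∉ Ω) : distCutoff Ω ε x = 0 := by
  simp [distCutoff, Metric.infDist_zero_of_mem (show x ∈ Ωᶜ from hx)]

theorem distCutoff_eq_one {E : Type*} [PseudoMetricSpace E] {Ω : Set E} {ε : ℝ} (hε : 0 < ε)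
    {x : E} (hx : ε ≤ Metric.infDist x Ωᶜ) : distCutoff Ω ε x = 1 := by
  refine min_eq_left ?_
  rw [inv_mul_eq_div]
  exact (one_le_div hε).2 hx

theorem fderiv_distCutoff_of_notMem {E : Type*} [NormedAddCommGroup E] [NormedSpace ℝ E]
    {Ω : Set E} {ε : ℝ} (hε : 0 < ε) {x : E} (hx : x ∉ Ω) :
    fderiv ℝ (distCutoff Ω ε) x = 0 := by
  refine IsLocalMin.fderiv_eq_zero (Eventually.of_forall fun z => ?_)
  rw [distCutoff_of_notMem ε hx]
  exact distCutoff_nonneg Ω hε z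

theorem fderiv_distCutoff_of_le {E : Type*} [NormedAddCommGroup E] [NormedSpace ℝ E]
    {Ω : Set E} {ε : ℝ} (hε : 0 < ε) {x : E} (hx : ε ≤ Metric.infDist x Ωᶜ) :
    fderiv ℝ (distCutoff Ω ε) x = 0 := by
  refine IsLocalMax.fderiv_eq_zero (Eventually.of_forall fun z => ?_)
  rw [distCutoff_eq_one hε hx]
  exact distCutoff_le_one Ω ε z

/-- In the boundary layer, the gradient of the cutoff is a multiple of the outward normal at a
nearest boundary point. -/
theorem fderiv_distCutoff_of_lt {E : Type*} [NormedAddCommGroup E] [InnerProductSpace ℝ E]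
    {Ω : Set E} (ho : IsOpen Ω) {ε : ℝ} (hε : 0 < ε) {x y m : E} (hx : x ∈ Ω)
    (hlt : Metric.infDist x Ωᶜ < ε) (hxy : Metric.infDist x Ωᶜ = dist x y) (hm : ‖m‖ = 1)
    (hsupp : ∀ z ∈ Ω, inner ℝ (z - y) m ≤ 0)
    (hd : DifferentiableAt ℝ (distCutoff Ω ε) x) (v : E) :
    fderiv ℝ (distCutoff Ω ε) x v = -(ε⁻¹ * inner ℝ m v) := by
  have hε' : 0 < ε⁻¹ := inv_pos.2 hε
  have hval : inner ℝ (y - x) m = Metric.infDist x Ωᶜ := by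
    refine le_antisymm ?_ (infDist_compl_le_of_support hm hsupp hx)
    have := real_inner_le_norm (y - x) m
    rwa [hm, mul_one, ← dist_eq_norm, dist_comm, ← hxy] at this
  set ℓ : E → ℝ := fun z => ε⁻¹ * inner ℝ m (y - z) with hℓ
  have hℓd : HasFDerivAt ℓ (-(ε⁻¹ • innerSL ℝ m)) x := by
    have h1 : HasFDerivAt (fun z : E => y - z) (-ContinuousLinearMap.id ℝ E) x :=
      (hasFDerivAt_id x).const_sub y
    have h2 := (((innerSL ℝ m).hasFDerivAt.comp x h1).const_mul ε⁻¹)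
    refine h2.congr_fderiv ?_
    ext v
    simp
  have hmin : IsLocalMin (fun z => ℓ z - distCutoff Ω ε z) x := by
    filter_upwards [ho.mem_nhds hx] with z hz
    have h0 : ℓ x - distCutoff Ω ε x = 0 := by
      have : distCutoff Ω ε x = ε⁻¹ * Metric.infDist x Ωᶜ := by
        refine min_eq_right ?_
        rw [inv_mul_eq_div]
        exact (div_le_one hε).2 hlt.le
      rw [this, hℓ]
      simp only
      rw [real_inner_comm, hval, sub_self]
    rw [h0, sub_nonneg]
    refine (min_le_right _ _).trans (mul_le_mul_of_nonneg_left ?_ hε'.le)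
    rw [real_inner_comm]
    exact infDist_compl_le_of_support hm hsupp hz
  have hzero := hmin.hasFDerivAt_eq_zero (hℓd.sub hd.hasFDerivAt)
  have := congrArg (fun A : E →L[ℝ] ℝ => A v) hzero
  simp at this
  linarith

theorem inner_euclidean_eq_sum {d : ℕ} (a b : Ed d) : inner ℝ a b = ∑ i, a i * b i := by
  simp [PiLp.inner_apply, mul_comm]

theorem lineDeriv_single_eq_pd {d : ℕ} {f : Ed d → ℝ} {x : Ed d} (hf : DifferentiableAt ℝ f x)
    (i : Fin d) : lineDeriv ℝ f x (EuclideanSpace.single i 1) = pd i f x :=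
  hf.lineDeriv_eq_fderiv

theorem abs_sum_pd_distCutoff_mul_le {d : ℕ} {Ω : Set (Ed d)} {n : Ed d → Ed d}
    (hdom : GoodDomain d Ω n) (hne : Ωᶜ.Nonempty) {G : Fin d → Ed d → ℝ} {C : NNReal}
    (hG : ∀ i, LipschitzWith C (G i))
    (hbc : ∀ x ∈ frontier Ω, ∑ i, G i x * n x i = 0) {ε : ℝ} (hε : 0 < ε) {x : Ed d}
    (hd : DifferentiableAt ℝ (distCutoff Ω ε) x) :
    |∑ i, pd i (distCutoff Ω ε) x * G i x| ≤ Ω.indicator (fun _ => (d : ℝ) * C) x := by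
  by_cases hx : x ∈ Ω
  swap
  · simp [pd, fderiv_distCutoff_of_notMem hε hx, hx]
  rw [indicator_of_mem hx]
  rcases le_or_gt ε (Metric.infDist x Ωᶜ) with hle | hlt
  · simp only [pd, fderiv_distCutoff_of_le hε hle]
    simp only [zero_apply, zero_mul, Finset.sum_const_zero, abs_zero]
    positivity
  obtain ⟨y, hy, hxy⟩ := exists_frontier_dist_eq_infDist_compl hdom.isOpen hne hx
  have hsupp : ∀ z ∈ Ω, inner ℝ (z - y) (n y) ≤ 0 := fun z hz => by
    rw [inner_euclidean_eq_sum]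
    exact hdom.normal_outward y hy z (subset_closure hz)
  have hn := hdom.normal_unit y hy
  have hpd : ∀ i, pd i (distCutoff Ω ε) x = -(ε⁻¹ * n y i) := fun i => by
    rw [pd, fderiv_distCutoff_of_lt hdom.isOpen hε hx hlt hxy hn hsupp hd]
    simp [inner_euclidean_eq_sum]
  have hsum : ∑ i, pd i (distCutoff Ω ε) x * G i x
      = ∑ i, -(ε⁻¹ * n y i * (G i x - G i y)) := by
    have : ∑ i, -(ε⁻¹ * n y i * (G i x - G i y))
        = ∑ i, pd i (distCutoff Ω ε) x * G i x + ε⁻¹ * ∑ i, G i y * n y i := by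
      rw [Finset.mul_sum, ← Finset.sum_add_distrib]
      refine Finset.sum_congr rfl fun i _ => ?_
      rw [hpd]
      ring
    rw [this, hbc y hy, mul_zero, add_zero]
  rw [hsum]
  refine (Finset.abs_sum_le_sum_abs _ _).trans ?_
  have : ∀ i ∈ Finset.univ, |-(ε⁻¹ * n y i * (G i x - G i y))| ≤ (C : ℝ) := fun i _ => by
    rw [abs_neg, abs_mul, abs_mul, abs_of_pos (inv_pos.2 hε)]
    have h1 : |n y i| ≤ 1 := by
      rw [← hn]
      exact PiLp.norm_apply_le (n y) i
    have h2 : |G i x - G i y| ≤ C * ε := by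
      have := (hG i).dist_le_mul x y
      rw [Real.dist_eq, ← hxy] at this
      exact this.trans (mul_le_mul_of_nonneg_left hlt.le C.2)
    calc ε⁻¹ * |n y i| * |G i x - G i y| ≤ ε⁻¹ * 1 * (C * ε) := by gcongr
      _ = C := by field_simp
  refine (Finset.sum_le_sum this).trans ?_
  simp

theorem GoodDomain.compl_nonempty {d : ℕ} {Ω : Set (Ed d)} {n : Ed d → Ed d}
    (hdom : GoodDomain d Ω n) : Ωᶜ.Nonempty := by
  have : Nonempty (Fin d) := ⟨⟨0, by rcases hdom.dims with h | h <;> omega⟩⟩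
  by_contra h
  rw [not_nonempty_iff_eq_empty, compl_empty_iff] at h
  exact NormedSpace.unbounded_univ ℝ (Ed d) (h ▸ hdom.bounded)

theorem hasCompactSupport_distCutoff {E : Type*} [PseudoMetricSpace E] [ProperSpace E]
    {Ω : Set E} (hb : Bornology.IsBounded Ω) (ε : ℝ) : HasCompactSupport (distCutoff Ω ε) :=
  HasCompactSupport.intro hb.isCompact_closure fun _ hx =>
    distCutoff_of_notMem ε fun h => hx (subset_closure h)

/-- Gauss theorem with vanishing normal flux, for compactly supported fields. -/
theorem integral_sum_pd_eq_zero_of_hasCompactSupport {d : ℕ} {Ω : Set (Ed d)} {n : Ed d → Ed d}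
    (hdom : GoodDomain d Ω n) {G : Fin d → Ed d → ℝ} (hG : ∀ i, ContDiff ℝ 1 (G i))
    (hc : ∀ i, HasCompactSupport (G i))
    (hbc : ∀ x ∈ frontier Ω, ∑ i, G i x * n x i = 0) :
    ∫ x in Ω, ∑ i, pd i (G i) x = 0 := by
  have hlip : ∃ C : NNReal, ∀ i, LipschitzWith C (G i) := by
    choose K hK using fun i => (hG i).lipschitzWith_of_hasCompactSupport (hc i) one_ne_zero
    exact ⟨∑ i, K i, fun i => (hK i).weaken (Finset.single_le_sum_of_canonicallyOrdered
      (Finset.mem_univ i))⟩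
  obtain ⟨C, hC⟩ := hlip
  set ε : ℕ → ℝ := fun k => 1 / ((k : ℝ) + 1) with hεdef
  have hε : ∀ k, 0 < ε k := fun k => Nat.one_div_pos_of_nat
  have hε0 : Tendsto ε atTop (𝓝 0) := tendsto_one_div_add_atTop_nhds_zero_nat
  have hcont : ∀ i, Continuous (pd i (G i)) := fun i =>
    ((hG i).continuous_fderiv one_ne_zero).clm_apply continuous_const
  have hcs : ∀ i, HasCompactSupport (pd i (G i)) := fun i => (hc i).fderiv_apply ℝ _
  have hΩm : MeasurableSet Ω := hdom.isOpen.measurableSet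
  have hlay : ∀ x ∈ Ω, ∀ᶠ k in atTop, ε k ≤ Metric.infDist x Ωᶜ := fun x hx => by
    have hpos : 0 < Metric.infDist x Ωᶜ :=
      (hdom.isOpen.isClosed_compl.notMem_iff_infDist_pos hdom.compl_nonempty).1 (by simpa using hx)
    exact (hε0.eventually (gt_mem_nhds hpos)).mono fun k hk => hk.le
  have hae : ∀ᵐ x : Ed d, ∀ k, DifferentiableAt ℝ (distCutoff Ω (ε k)) x :=
    ae_all_iff.2 fun k => (lipschitzWith_distCutoff Ω (ε k)).ae_differentiableAt
  have hmeas : ∀ k, Continuous (distCutoff Ω (ε k)) := fun k =>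
    (lipschitzWith_distCutoff Ω (ε k)).continuous
  have hibp : ∀ k, ∫ x, distCutoff Ω (ε k) x * ∑ i, pd i (G i) x
      = - ∫ x, ∑ i, pd i (distCutoff Ω (ε k)) x * G i x := fun k => by
    have hi1 : ∀ i, Integrable (fun x => distCutoff Ω (ε k) x * pd i (G i) x) := fun i =>
      ((hmeas k).mul (hcont i)).integrable_of_hasCompactSupport (hcs i).mul_left
    have hi2 : ∀ i, Integrable (fun x => pd i (distCutoff Ω (ε k)) x * G i x) := fun i => by
      refine Integrable.bdd_mul
        ((hG i).continuous.integrable_of_hasCompactSupport (hc i))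
        (measurable_fderiv_apply_const ℝ _ _).aestronglyMeasurable (c := ‖(ε k)⁻¹‖)
        (Eventually.of_forall fun x => ?_)
      have h1 := norm_fderiv_le_of_lipschitz ℝ (x₀ := x) (lipschitzWith_distCutoff Ω (ε k))
      have h2 := (fderiv ℝ (distCutoff Ω (ε k)) x).le_opNorm (EuclideanSpace.single i 1)
      simpa [pd] using h2.trans (mul_le_mul_of_nonneg_right h1 (norm_nonneg _))
    simp_rw [Finset.mul_sum]
    rw [integral_finsetSum _ fun i _ => hi1 i, integral_finsetSum _ fun i _ => hi2 i,
      ← Finset.sum_neg_distrib]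
    refine Finset.sum_congr rfl fun i _ => ?_
    have h := (lipschitzWith_distCutoff Ω (ε k)).integral_lineDeriv_mul_eq (μ := volume)
      (hC i) (hc i) (EuclideanSpace.single i 1)
    rw [← integral_neg]
    have hl : ∫ x, lineDeriv ℝ (distCutoff Ω (ε k)) x (EuclideanSpace.single i 1) * G i x
        = ∫ x, pd i (distCutoff Ω (ε k)) x * G i x := by
      refine integral_congr_ae ?_
      filter_upwards [hae] with x hx
      rw [lineDeriv_single_eq_pd (hx k)]
    have hr : ∫ x, lineDeriv ℝ (G i) x (-EuclideanSpace.single i 1) * distCutoff Ω (ε k) x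
        = - ∫ x, distCutoff Ω (ε k) x * pd i (G i) x := by
      rw [← integral_neg]
      refine integral_congr_ae (Eventually.of_forall fun x => ?_)
      simp only
      rw [lineDeriv_neg, lineDeriv_single_eq_pd ((hG i).differentiable one_ne_zero x)]
      ring
    rw [hl, hr] at h
    rw [integral_neg, h, neg_neg]
  have hlim1 : Tendsto (fun k => ∫ x, distCutoff Ω (ε k) x * ∑ i, pd i (G i) x) atTop
      (𝓝 (∫ x, Ω.indicator (fun x => ∑ i, pd i (G i) x) x)) := by
    refine tendsto_integral_of_dominated_convergence (fun x => |∑ i, pd i (G i) x|)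
      (fun k => ((hmeas k).mul (continuous_finsetSum _ fun i _ => hcont i)).aestronglyMeasurable)
      ?_ (fun k => Eventually.of_forall fun x => ?_) (Eventually.of_forall fun x => ?_)
    · exact (integrable_finsetSum _ fun i _ =>
        (hcont i).integrable_of_hasCompactSupport (hcs i)).abs
    · rw [norm_mul, Real.norm_eq_abs, Real.norm_eq_abs, abs_of_nonneg (distCutoff_nonneg Ω (hε k) x)]
      exact mul_le_of_le_one_left (abs_nonneg _) (distCutoff_le_one Ω _ x)
    · by_cases hx : x ∈ Ω
      · rw [indicator_of_mem hx]
        refine tendsto_const_nhds.congr' ?_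
        filter_upwards [hlay x hx] with k hk
        rw [distCutoff_eq_one (hε k) hk, one_mul]
      · rw [indicator_of_notMem hx]
        simp [distCutoff_of_notMem _ hx]
  have hlim2 : Tendsto (fun k => ∫ x, ∑ i, pd i (distCutoff Ω (ε k)) x * G i x) atTop
      (𝓝 (∫ _ : Ed d, (0 : ℝ))) := by
    refine tendsto_integral_of_dominated_convergence (Ω.indicator fun _ => (d : ℝ) * C)
      (fun k => ?_) ?_ (fun k => ?_) (Eventually.of_forall fun x => ?_)
    · exact (Finset.measurable_sum _ fun i _ => (measurable_fderiv_apply_const ℝ _ _).mul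
        (hG i).continuous.measurable).aestronglyMeasurable
    · rw [integrable_indicator_iff hΩm]
      exact integrableOn_const hdom.bounded.measure_lt_top.ne
    · filter_upwards [hae] with x hx
      exact abs_sum_pd_distCutoff_mul_le hdom hdom.compl_nonempty hC hbc (hε k) (hx k)
    · refine tendsto_const_nhds.congr' ?_
      by_cases hx : x ∈ Ω
      · filter_upwards [hlay x hx] with k hk
        simp [pd, fderiv_distCutoff_of_le (hε k) hk]
      · exact Eventually.of_forall fun k => by simp [pd, fderiv_distCutoff_of_notMem (hε k) hx]
  have hlim3 := hlim2.neg
  simp only [← hibp] at hlim3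
  have := tendsto_nhds_unique hlim1 hlim3
  rwa [integral_indicator hΩm, integral_zero, neg_zero] at this

/-- Gauss theorem with vanishing normal flux. -/
theorem integral_sum_pd_eq_zero {d : ℕ} {Ω : Set (Ed d)} {n : Ed d → Ed d}
    (hdom : GoodDomain d Ω n) {G : Fin d → Ed d → ℝ} (hG : ∀ i, ContDiff ℝ 1 (G i))
    (hbc : ∀ x ∈ frontier Ω, ∑ i, G i x * n x i = 0) :
    ∫ x in Ω, ∑ i, pd i (G i) x = 0 := by
  obtain ⟨R, hR0, hR⟩ := hdom.bounded.subset_ball_lt 0 0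
  let ρ : ContDiffBump (0 : Ed d) := ⟨R, R + 1, hR0, by linarith⟩
  have h := integral_sum_pd_eq_zero_of_hasCompactSupport hdom (G := fun i x => ρ x * G i x)
    (fun i => ρ.contDiff.mul (hG i)) (fun i => ρ.hasCompactSupport.mul_right) (fun x hx => by
      simp_rw [mul_assoc]
      rw [← Finset.mul_sum, hbc x hx, mul_zero])
  rw [← h]
  refine setIntegral_congr_fun hdom.isOpen.measurableSet fun x hx =>
    Finset.sum_congr rfl fun i _ => ?_
  have : G i =ᶠ[𝓝 x] fun y => ρ y * G i y := by
    filter_upwards [Metric.isOpen_ball.mem_nhds (hR hx)] with y hy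
    rw [ρ.one_of_mem_closedBall (Metric.ball_subset_closedBall hy), one_mul]
  rw [pd, pd, this.fderiv_eq]

open scoped ContDiff

theorem ContDiff.pd {d : ℕ} {f : Ed d → ℝ} (hf : ContDiff ℝ ∞ f) (i : Fin d) :
    ContDiff ℝ ∞ (pd i f) :=
  (hf.fderiv_right le_rfl).clm_apply contDiff_const

theorem pd_mul {d : ℕ} {f g : Ed d → ℝ} (hf : ContDiff ℝ ∞ f) (hg : ContDiff ℝ ∞ g)
    (i : Fin d) (x : Ed d) :
    pd i (fun y => f y * g y) x = pd i f x * g x + f x * pd i g x := by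
  have h : HasFDerivAt (fun y => f y * g y) _ x :=
    (hf.differentiable (by simp) x).hasFDerivAt.mul (hg.differentiable (by simp) x).hasFDerivAt
  rw [pd, h.fderiv]
  simp [pd]
  ring

theorem pd_sum {d : ℕ} {ι : Type*} (s : Finset ι) {f : ι → Ed d → ℝ}
    (hf : ∀ j, ContDiff ℝ ∞ (f j)) (i : Fin d) (x : Ed d) :
    pd i (fun y => ∑ j ∈ s, f j y) x = ∑ j ∈ s, pd i (f j) x := by
  rw [pd, fderiv_fun_sum fun j _ => (hf j).differentiable (by simp) x]
  simp [pd]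

theorem fderiv_fderiv_apply_comm {E : Type*} [NormedAddCommGroup E] [NormedSpace ℝ E]
    {f : E → ℝ} (hf : ContDiff ℝ ∞ f) (x a b : E) :
    fderiv ℝ (fun y => fderiv ℝ f y a) x b = fderiv ℝ (fun y => fderiv ℝ f y b) x a := by
  have hd : DifferentiableAt ℝ (fderiv ℝ f) x :=
    (hf.fderiv_right (m := ∞) le_rfl).differentiable (by simp) x
  have key : ∀ c v, fderiv ℝ (fun y => fderiv ℝ f y c) x v = fderiv ℝ (fderiv ℝ f) x v c := by
    intro c v
    rw [fderiv_clm_apply hd (differentiableAt_const c)]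
    simp
  rw [key, key]
  exact ((contDiff_infty.1 hf 2).contDiffAt.isSymmSndFDerivAt (by simp)) b a

theorem pd_comm {d : ℕ} {f : Ed d → ℝ} (hf : ContDiff ℝ ∞ f) (i j : Fin d) (x : Ed d) :
    pd i (pd j f) x = pd j (pd i f) x :=
  fderiv_fderiv_apply_comm hf x _ _

theorem contDiff_curlM {d : ℕ} {w : Ed d → Ed d} (hw : ContDiff ℝ ∞ w) (i j : Fin d) :
    ContDiff ℝ ∞ (fun y => curlM w y i j) :=
  ((contDiff_euclidean.1 hw j).pd i).sub ((contDiff_euclidean.1 hw i).pd j)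

theorem contDiff_divg {d : ℕ} {w : Ed d → Ed d} (hw : ContDiff ℝ ∞ w) :
    ContDiff ℝ ∞ (divg w) :=
  ContDiff.sum fun i _ => (contDiff_euclidean.1 hw i).pd i

theorem contDiff_ccurl {d : ℕ} {w : Ed d → Ed d} (hw : ContDiff ℝ ∞ w) (j : Fin d) :
    ContDiff ℝ ∞ (fun y => ccurl w y j) :=
  ContDiff.sum fun i _ => (contDiff_curlM hw j i).pd i

theorem curlM_antisymm {d : ℕ} (w : Ed d → Ed d) (x : Ed d) (i j : Fin d) :
    curlM w x i j = -curlM w x j i := by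
  simp [curlM]

/-- The gradient as a vector field. -/
noncomputable def gradField {d : ℕ} (f : Ed d → ℝ) (x : Ed d) : Ed d :=
  WithLp.toLp 2 fun i => pd i f x

theorem contDiff_gradField {d : ℕ} {f : Ed d → ℝ} (hf : ContDiff ℝ ∞ f) :
    ContDiff ℝ ∞ (gradField f) :=
  contDiff_euclidean.2 fun i => hf.pd i

theorem curlM_gradField {d : ℕ} {f : Ed d → ℝ} (hf : ContDiff ℝ ∞ f) (x : Ed d) (i j : Fin d) :
    curlM (gradField f) x i j = 0 :=
  sub_eq_zero.2 (pd_comm hf i j x)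

theorem Continuous.integrableOn_of_isBounded {d : ℕ} {Ω : Set (Ed d)}
    (hb : Bornology.IsBounded Ω) {f : Ed d → ℝ} (hf : Continuous f) : IntegrableOn f Ω :=
  (hf.continuousOn.integrableOn_compact hb.isCompact_closure).mono_set subset_closure

/-- Integration by parts for the divergence of a field tangent to the boundary. -/
theorem integral_mul_divg {d : ℕ} {Ω : Set (Ed d)} {n : Ed d → Ed d}
    (hdom : GoodDomain d Ω n) {φ : Ed d → ℝ} {w : Ed d → Ed d} (hφ : ContDiff ℝ ∞ φ)
    (hw : ContDiff ℝ ∞ w) (hbc : ∀ x ∈ frontier Ω, ∑ i, w x i * n x i = 0) :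
    ∫ x in Ω, φ x * divg w x = -∫ x in Ω, ∑ i, pd i φ x * w x i := by
  have hwi := contDiff_euclidean.1 hw
  have hp := fun i => hφ.pd i
  have hdiv := contDiff_divg hw
  have h := integral_sum_pd_eq_zero hdom (G := fun i x => φ x * w x i)
    (fun i => (hφ.mul (hwi i)).of_le (by simp)) (fun x hx => by
      simp_rw [mul_assoc]
      rw [← Finset.mul_sum, hbc x hx, mul_zero])
  have hi1 : IntegrableOn (fun x => φ x * divg w x) Ω :=
    (hφ.continuous.mul hdiv.continuous).integrableOn_of_isBounded hdom.bounded
  have hi2 : IntegrableOn (fun x => ∑ i, pd i φ x * w x i) Ω :=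
    (continuous_finsetSum _ fun i _ =>
      (hp i).continuous.mul (hwi i).continuous).integrableOn_of_isBounded hdom.bounded
  rw [eq_neg_iff_add_eq_zero, ← integral_add hi1 hi2, ← h]
  congr 1 with x
  rw [divg, Finset.mul_sum, ← Finset.sum_add_distrib]
  refine Finset.sum_congr rfl fun i _ => ?_
  rw [pd_mul hφ (hwi i)]
  ring

theorem sum_curlM_mul_pd {d : ℕ} (w z : Ed d → Ed d) (x : Ed d) :
    ∑ i, ∑ j, curlM w x j i * pd i (fun y => z y j) x
      = -((1 / 2) * ∑ i, ∑ j, curlM w x i j * curlM z x i j) := by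
  have h1 : ∑ i, ∑ j, curlM w x i j * curlM z x i j
      = ∑ i, ∑ j, curlM w x i j * pd i (fun y => z y j) x
        - ∑ i, ∑ j, curlM w x i j * pd j (fun y => z y i) x := by
    simp only [← Finset.sum_sub_distrib, ← mul_sub]
    rfl
  have h2 : ∑ i, ∑ j, curlM w x i j * pd i (fun y => z y j) x
      = -∑ i, ∑ j, curlM w x j i * pd i (fun y => z y j) x := by
    simp only [← Finset.sum_neg_distrib]
    refine Finset.sum_congr rfl fun i _ => Finset.sum_congr rfl fun j _ => ?_
    rw [curlM_antisymm w x i j]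
    ring
  have h3 : ∑ i, ∑ j, curlM w x i j * pd j (fun y => z y i) x
      = ∑ i, ∑ j, curlM w x j i * pd i (fun y => z y j) x := Finset.sum_comm
  rw [h1, h2, h3]
  ring

/-- Integration by parts for `curl curl w` when `𝒩 w = 0` on the boundary. -/
theorem integral_ccurl_mul {d : ℕ} {Ω : Set (Ed d)} {n : Ed d → Ed d}
    (hdom : GoodDomain d Ω n) {w z : Ed d → Ed d} (hw : ContDiff ℝ ∞ w) (hz : ContDiff ℝ ∞ z)
    (hbc : ∀ x ∈ frontier Ω, ∀ i, ∑ j, curlM w x i j * n x j = 0) :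
    ∫ x in Ω, ∑ j, ccurl w x j * z x j
      = ∫ x in Ω, (1 / 2) * ∑ i, ∑ j, curlM w x i j * curlM z x i j := by
  have hzi := contDiff_euclidean.1 hz
  have hcw := fun i j => contDiff_curlM hw i j
  have hcz := fun i j => contDiff_curlM hz i j
  have hcc := fun j => contDiff_ccurl hw j
  have hm : ∀ i j, ContDiff ℝ ∞ fun x => curlM w x j i * z x j := fun i j =>
    (hcw j i).mul (hzi j)
  have h := integral_sum_pd_eq_zero hdom (G := fun i x => ∑ j, curlM w x j i * z x j)
    (fun i => (ContDiff.sum fun j _ => hm i j).of_le (by simp)) (fun x hx => by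
      simp_rw [Finset.sum_mul]
      rw [Finset.sum_comm]
      refine Finset.sum_eq_zero fun j _ => ?_
      rw [← mul_zero (z x j), ← hbc x hx j, Finset.mul_sum]
      exact Finset.sum_congr rfl fun i _ => by ring)
  rw [← sub_eq_zero, ← integral_sub, ← h]
  · congr 1 with x
    simp_rw [pd_sum _ (hm _), pd_mul (hcw _ _) (hzi _), Finset.sum_add_distrib,
      sum_curlM_mul_pd, ccurl, Finset.sum_mul]
    rw [Finset.sum_comm, sub_eq_add_neg]
  · exact (continuous_finsetSum _ fun j _ =>
      (hcc j).continuous.mul (hzi j).continuous).integrableOn_of_isBounded hdom.bounded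
  · exact (continuous_const.mul (continuous_finsetSum _ fun i _ => continuous_finsetSum _ fun j _ =>
      (hcw i j).continuous.mul (hcz i j).continuous)).integrableOn_of_isBounded hdom.bounded

/-- `curl curl w` is orthogonal to gradients when `𝒩 w = 0` on the boundary. -/
theorem integral_ccurl_mul_pd {d : ℕ} {Ω : Set (Ed d)} {n : Ed d → Ed d}
    (hdom : GoodDomain d Ω n) {w : Ed d → Ed d} {φ : Ed d → ℝ} (hw : ContDiff ℝ ∞ w)
    (hφ : ContDiff ℝ ∞ φ) (hbc : ∀ x ∈ frontier Ω, ∀ i, ∑ j, curlM w x i j * n x j = 0) :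
    ∫ x in Ω, ∑ j, ccurl w x j * pd j φ x = 0 := by
  have h := integral_ccurl_mul hdom hw (contDiff_gradField hφ) hbc
  simpa [curlM_gradField hφ, gradField] using h

section SpaceTime

variable {d : ℕ} {F : Type*} [NormedAddCommGroup F] [NormedSpace ℝ F]

/-- Joint smoothness of a time-dependent field. -/
def SpaceTimeSmooth (f : ℝ → Ed d → F) : Prop :=
  ContDiff ℝ ∞ fun p : ℝ × Ed d => f p.1 p.2

namespace SpaceTimeSmooth

theorem slice {f : ℝ → Ed d → F} (hf : SpaceTimeSmooth f) (t : ℝ) : ContDiff ℝ ∞ (f t) :=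
  hf.comp (contDiff_const.prodMk contDiff_id)

theorem comp_apply {w : ℝ → Ed d → Ed d} (hw : SpaceTimeSmooth w) (j : Fin d) :
    SpaceTimeSmooth fun t x => w t x j :=
  contDiff_euclidean.1 hw j

theorem hasDerivAt_fderiv {f : ℝ → Ed d → F} (hf : SpaceTimeSmooth f) (t : ℝ) (x : Ed d) :
    HasDerivAt (fun s => f s x) (fderiv ℝ (fun p : ℝ × Ed d => f p.1 p.2) (t, x) (1, 0)) t := by
  have h1 : HasFDerivAt (fun p : ℝ × Ed d => f p.1 p.2) _ (t, x) :=
    (hf.differentiable (by simp) (t, x)).hasFDerivAt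
  exact h1.comp_hasDerivAt t ((hasDerivAt_id t).prodMk (hasDerivAt_const t x))

theorem tder_eq {f : ℝ → Ed d → F} (hf : SpaceTimeSmooth f) (t : ℝ) (x : Ed d) :
    tder f t x = fderiv ℝ (fun p : ℝ × Ed d => f p.1 p.2) (t, x) (1, 0) :=
  (hf.hasDerivAt_fderiv t x).deriv

theorem hasDerivAt {f : ℝ → Ed d → F} (hf : SpaceTimeSmooth f) (t : ℝ) (x : Ed d) :
    HasDerivAt (fun s => f s x) (tder f t x) t :=
  hf.tder_eq t x ▸ hf.hasDerivAt_fderiv t x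

theorem tder {f : ℝ → Ed d → F} (hf : SpaceTimeSmooth f) : SpaceTimeSmooth (tder f) := by
  have h : ContDiff ℝ ∞ fun p : ℝ × Ed d =>
      fderiv ℝ (fun p : ℝ × Ed d => f p.1 p.2) p (1, 0) :=
    (ContDiff.fderiv_right hf le_rfl).clm_apply contDiff_const
  simpa only [SpaceTimeSmooth, hf.tder_eq] using h

theorem pd_eq {f : ℝ → Ed d → ℝ} (hf : SpaceTimeSmooth f) (i : Fin d) (t : ℝ) (x : Ed d) :
    pd i (f t) x =
      fderiv ℝ (fun p : ℝ × Ed d => f p.1 p.2) (t, x) (0, EuclideanSpace.single i 1) := by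
  have h1 : HasFDerivAt (fun p : ℝ × Ed d => f p.1 p.2) _ (t, x) :=
    (hf.differentiable (by simp) (t, x)).hasFDerivAt
  have h2 : HasFDerivAt (f t) _ x := h1.comp x (hasFDerivAt_prodMk_right t x)
  rw [pd, h2.fderiv]
  simp

theorem pd {f : ℝ → Ed d → ℝ} (hf : SpaceTimeSmooth f) (i : Fin d) :
    SpaceTimeSmooth fun t x => pd i (f t) x := by
  have h : ContDiff ℝ ∞ fun p : ℝ × Ed d =>
      fderiv ℝ (fun p : ℝ × Ed d => f p.1 p.2) p (0, EuclideanSpace.single i 1) :=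
    (ContDiff.fderiv_right hf le_rfl).clm_apply contDiff_const
  simpa only [SpaceTimeSmooth, hf.pd_eq] using h

theorem hasDerivAt_pd {f : ℝ → Ed d → ℝ} (hf : SpaceTimeSmooth f) (i : Fin d) (t : ℝ)
    (x : Ed d) : HasDerivAt (fun s => _root_.pd i (f s) x) (_root_.pd i (_root_.tder f t) x) t := by
  refine ((hf.pd i).hasDerivAt t x).congr_deriv ?_
  rw [(hf.pd i).tder_eq, hf.tder.pd_eq]
  simp_rw [hf.pd_eq, hf.tder_eq]
  exact fderiv_fderiv_apply_comm hf _ _ _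

theorem hasDerivAt_apply {w : ℝ → Ed d → Ed d} (hw : SpaceTimeSmooth w) (t : ℝ) (x : Ed d)
    (j : Fin d) : HasDerivAt (fun s => w s x j) (_root_.tder w t x j) t :=
  (EuclideanSpace.proj (𝕜 := ℝ) j).hasFDerivAt.comp_hasDerivAt t (hw.hasDerivAt t x)

theorem tder_apply {w : ℝ → Ed d → Ed d} (hw : SpaceTimeSmooth w) (t : ℝ) (x : Ed d)
    (j : Fin d) : _root_.tder (fun s y => w s y j) t x = _root_.tder w t x j :=
  (hw.hasDerivAt_apply t x j).deriv

theorem hasDerivAt_pd_apply {w : ℝ → Ed d → Ed d} (hw : SpaceTimeSmooth w) (i j : Fin d) (t : ℝ)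
    (x : Ed d) : HasDerivAt (fun s => _root_.pd i (fun y => w s y j) x)
      (_root_.pd i (fun y => _root_.tder w t y j) x) t := by
  simpa only [← hw.tder_apply] using (hw.comp_apply j).hasDerivAt_pd i t x

theorem divg {w : ℝ → Ed d → Ed d} (hw : SpaceTimeSmooth w) :
    SpaceTimeSmooth fun t x => divg (w t) x :=
  ContDiff.sum fun i _ => (hw.comp_apply i).pd i

theorem curlM {w : ℝ → Ed d → Ed d} (hw : SpaceTimeSmooth w) (i j : Fin d) :
    SpaceTimeSmooth fun t x => curlM (w t) x i j :=
  ContDiff.sub ((hw.comp_apply j).pd i) ((hw.comp_apply i).pd j)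

theorem ccurl {w : ℝ → Ed d → Ed d} (hw : SpaceTimeSmooth w) (j : Fin d) :
    SpaceTimeSmooth fun t x => ccurl (w t) x j :=
  ContDiff.sum fun i _ => (hw.curlM j i).pd i

theorem hasDerivAt_divg {w : ℝ → Ed d → Ed d} (hw : SpaceTimeSmooth w) (t : ℝ) (x : Ed d) :
    HasDerivAt (fun s => _root_.divg (w s) x) (_root_.divg (_root_.tder w t) x) t :=
  HasDerivAt.fun_sum fun i _ => hw.hasDerivAt_pd_apply i i t x

theorem hasDerivAt_curlM {w : ℝ → Ed d → Ed d} (hw : SpaceTimeSmooth w) (i j : Fin d) (t : ℝ)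
    (x : Ed d) : HasDerivAt (fun s => _root_.curlM (w s) x i j)
      (_root_.curlM (_root_.tder w t) x i j) t :=
  (hw.hasDerivAt_pd_apply i j t x).sub (hw.hasDerivAt_pd_apply j i t x)

theorem hasDerivAt_pd_divg {w : ℝ → Ed d → Ed d} (hw : SpaceTimeSmooth w) (i : Fin d) (t : ℝ)
    (x : Ed d) : HasDerivAt (fun s => _root_.pd i (_root_.divg (w s)) x)
      (_root_.pd i (_root_.divg (_root_.tder w t)) x) t := by
  have h : _root_.tder (fun s y => _root_.divg (w s) y) t = _root_.divg (_root_.tder w t) :=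
    funext fun y => (hw.hasDerivAt_divg t y).deriv
  exact h ▸ hw.divg.hasDerivAt_pd i t x

theorem hasDerivAt_ccurl {w : ℝ → Ed d → Ed d} (hw : SpaceTimeSmooth w) (j : Fin d) (t : ℝ)
    (x : Ed d) : HasDerivAt (fun s => _root_.ccurl (w s) x j)
      (_root_.ccurl (_root_.tder w t) x j) t := by
  refine HasDerivAt.fun_sum fun i _ => ?_
  have h : _root_.tder (fun s y => _root_.curlM (w s) y j i) t
      = fun y => _root_.curlM (_root_.tder w t) y j i :=
    funext fun y => (hw.hasDerivAt_curlM j i t y).deriv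
  exact h ▸ (hw.curlM j i).hasDerivAt_pd i t x

/-- Differentiation under the integral sign over a bounded open set. -/
theorem hasDerivAt_setIntegral {Ω : Set (Ed d)} (hb : Bornology.IsBounded Ω)
    (hΩ : MeasurableSet Ω) {f f' : ℝ → Ed d → ℝ} (hf : SpaceTimeSmooth f)
    (hf' : ∀ t x, HasDerivAt (fun s => f s x) (f' t x) t) (t : ℝ) :
    HasDerivAt (fun s => ∫ x in Ω, f s x) (∫ x in Ω, f' t x) t := by
  obtain rfl : _root_.tder f = f' := funext fun s => funext fun x => (hf' s x).deriv
  have hK : IsCompact (Metric.closedBall t 1 ×ˢ closure Ω) :=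
    (isCompact_closedBall t 1).prod hb.isCompact_closure
  obtain ⟨C, hC⟩ := hK.exists_bound_of_continuousOn (ContDiff.continuous hf.tder).continuousOn
  refine (hasDerivAt_integral_of_dominated_loc_of_deriv_le (bound := fun _ => C)
    (Metric.ball_mem_nhds t one_pos)
    (Eventually.of_forall fun s => (hf.slice s).continuous.aestronglyMeasurable)
    ((hf.slice t).continuous.integrableOn_of_isBounded hb)
    (hf.tder.slice t).continuous.aestronglyMeasurable ?_
    (integrableOn_const hb.measure_lt_top.ne)
    (Eventually.of_forall fun x s _ => hf.hasDerivAt s x)).2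
  refine (ae_restrict_mem hΩ).mono fun x hx s hs => ?_
  exact hC (s, x) ⟨Metric.ball_subset_closedBall hs, subset_closure hx⟩

end SpaceTimeSmooth

end SpaceTime

theorem HasDerivAt.eq_zero_of_forall_pos {g : ℝ → ℝ} {g' t : ℝ} (hg : HasDerivAt g g' t)
    (ht : 0 < t) (h0 : ∀ s, 0 < s → g s = 0) : g' = 0 := by
  refine hg.unique ((hasDerivAt_const t (0 : ℝ)).congr_of_eventuallyEq ?_)
  filter_upwards [lt_mem_nhds ht] with s hs using h0 s hs

theorem sum_tder_mul_eq_zero {d : ℕ} {w : ℝ → Ed d → Ed d} (hw : SpaceTimeSmooth w) {x m : Ed d}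
    (h : ∀ t, 0 < t → ∑ i, w t x i * m i = 0) :
    ∀ t, 0 < t → ∑ i, tder w t x i * m i = 0 := fun t ht =>
  HasDerivAt.eq_zero_of_forall_pos (HasDerivAt.fun_sum fun i _ =>
    (hw.hasDerivAt_apply t x i).mul_const (m i)) ht h

theorem sum_curlM_tder_mul_eq_zero {d : ℕ} {w : ℝ → Ed d → Ed d} (hw : SpaceTimeSmooth w)
    {x m : Ed d} (i : Fin d) (h : ∀ t, 0 < t → ∑ j, curlM (w t) x i j * m j = 0) :
    ∀ t, 0 < t → ∑ j, curlM (tder w t) x i j * m j = 0 := fun t ht =>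
  HasDerivAt.eq_zero_of_forall_pos (HasDerivAt.fun_sum fun j _ =>
    (hw.hasDerivAt_curlM i j t x).mul_const (m j)) ht h

/-- The wave equation tested against a smooth vector field. -/
theorem IsSolution.integral_sum_mul_tder_tder {d : ℕ} {Ω : Set (Ed d)} {n : Ed d → Ed d}
    {μ lam ν : ℝ} {u : ℝ → Ed d → Ed d} {θ : ℝ → Ed d → ℝ} (hdom : GoodDomain d Ω n)
    (hsol : IsSolution Ω n μ lam ν u θ) {t : ℝ} (ht : 0 < t) {a : Fin d → Ed d → ℝ}
    (ha : ∀ j, Continuous (a j)) :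
    ∫ x in Ω, ∑ j, a j x * tder (tder u) t x j
      = (2 * μ + lam) * (∫ x in Ω, ∑ j, a j x * pd j (divg (u t)) x)
        - μ * (∫ x in Ω, ∑ j, a j x * ccurl (u t) x j)
        - ν * ∫ x in Ω, ∑ j, a j x * pd j (θ t) x := by
  have hu : SpaceTimeSmooth u := hsol.smooth_u
  have hθ : SpaceTimeSmooth θ := hsol.smooth_θ
  have hint : ∀ {b : Fin d → Ed d → ℝ}, (∀ j, Continuous (b j)) →
      IntegrableOn (fun x => ∑ j, a j x * b j x) Ω := fun hb =>
    (continuous_finsetSum _ fun j _ => (ha j).mul (hb j)).integrableOn_of_isBounded hdom.bounded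
  have h1 := (hint fun j => ((contDiff_divg (hu.slice t)).pd j).continuous).const_mul (2 * μ + lam)
  have h2 := (hint fun j => (contDiff_ccurl (hu.slice t) j).continuous).const_mul μ
  have h3 := (hint fun j => ((hθ.slice t).pd j).continuous).const_mul ν
  have h12 : IntegrableOn (fun x => (2 * μ + lam) * (∑ j, a j x * pd j (divg (u t)) x)
      - μ * ∑ j, a j x * ccurl (u t) x j) Ω := h1.sub h2
  rw [← integral_const_mul, ← integral_const_mul, ← integral_const_mul,
    ← integral_sub h1 h2, ← integral_sub h12 h3]
  refine setIntegral_congr_fun hdom.isOpen.measurableSet fun x hx => ?_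
  simp only [Finset.mul_sum, ← Finset.sum_sub_distrib]
  refine Finset.sum_congr rfl fun j _ => ?_
  linear_combination a j x * hsol.wave t ht x hx j

/-- the identity for the time derivative of the higher-order
elastic energy. -/
theorem higher_order_energy_identity {d : ℕ} {Ω : Set (Ed d)} {n : Ed d → Ed d}
    {μ lam ν : ℝ} {u : ℝ → Ed d → Ed d} {θ : ℝ → Ed d → ℝ}
    (hdom : GoodDomain d Ω n) (hμ : 0 < μ) (hlam : 0 < 2 * μ + (d : ℝ) * lam)
    (hsol : IsSolution Ω n μ lam ν u θ) :
    ∀ t : ℝ, 0 < t → ∃ F' : ℝ,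
      HasDerivAt (fun s =>
          (∫ x in Ω, (divg (tder u s) x) ^ 2)
          + (∫ x in Ω, curlNormSq (tder u s) x)
          + (2 * μ + lam) * (∫ x in Ω, gradNormSq (divg (u s)) x)
          + μ * (∫ x in Ω, ∑ j, (ccurl (u s) x j) ^ 2)) F' t ∧
      (1 / 2) * F' = -ν * ∫ x in Ω, lap (θ t) x * divg (tder u t) x := by
  intro t ht
  have hu : SpaceTimeSmooth u := hsol.smooth_u
  have hθ : ContDiff ℝ ∞ (θ t) := SpaceTimeSmooth.slice hsol.smooth_θ t
  have hv := hu.tder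
  have hw := hv.tder
  have hΩ := hdom.isOpen.measurableSet
  have hbc_w : ∀ x ∈ frontier Ω, ∑ i, tder (tder u) t x i * n x i = 0 := fun x hx =>
    sum_tder_mul_eq_zero hv (sum_tder_mul_eq_zero hu fun s hs => hsol.bc_u s hs x hx) t ht
  have hbc_v : ∀ x ∈ frontier Ω, ∀ i, ∑ j, curlM (tder u t) x i j * n x j = 0 := fun x hx i =>
    sum_curlM_tder_mul_eq_zero hu i (fun s hs => hsol.bc_N s hs x hx i) t ht
  have hdv := contDiff_divg (hv.slice t)
  have hdu := contDiff_divg (hu.slice t)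
  have hdiv : ∫ x in Ω, divg (tder u t) x * divg (tder (tder u) t) x
      = -((2 * μ + lam) * (∫ x in Ω, ∑ j, pd j (divg (tder u t)) x * pd j (divg (u t)) x)
        - ν * ∫ x in Ω, ∑ j, pd j (divg (tder u t)) x * pd j (θ t) x) := by
    rw [integral_mul_divg hdom hdv (hw.slice t) hbc_w,
      hsol.integral_sum_mul_tder_tder hdom ht fun j => (hdv.pd j).continuous]
    have h := integral_ccurl_mul_pd hdom (hu.slice t) hdv (hsol.bc_N t ht)
    simp only [mul_comm (ccurl _ _ _)] at h
    rw [h, mul_zero, sub_zero]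
  have hcurl : ∫ x in Ω, (1 / 2) * ∑ i, ∑ j,
        curlM (tder u t) x i j * curlM (tder (tder u) t) x i j
      = -(μ * ∫ x in Ω, ∑ j, ccurl (tder u t) x j * ccurl (u t) x j) := by
    rw [← integral_ccurl_mul hdom (hv.slice t) (hw.slice t) hbc_v,
      hsol.integral_sum_mul_tder_tder hdom ht fun j => (contDiff_ccurl (hv.slice t) j).continuous,
      integral_ccurl_mul_pd hdom (hv.slice t) hdu hbc_v,
      integral_ccurl_mul_pd hdom (hv.slice t) hθ hbc_v]
    ring
  have htheta : ∫ x in Ω, lap (θ t) x * divg (tder u t) x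
      = -∫ x in Ω, ∑ j, pd j (divg (tder u t)) x * pd j (θ t) x := by
    have h := integral_mul_divg hdom hdv (contDiff_gradField hθ) (hsol.bc_θ t ht)
    simp only [mul_comm (divg (tder u t) _)] at h
    exact h
  have h1 := SpaceTimeSmooth.hasDerivAt_setIntegral hdom.bounded hΩ
    (f := fun s x => divg (tder u s) x ^ 2) (ContDiff.pow hv.divg 2)
    (fun s x => (hv.hasDerivAt_divg s x).fun_pow 2) t
  have h2 := SpaceTimeSmooth.hasDerivAt_setIntegral hdom.bounded hΩ
    (f := fun s x => curlNormSq (tder u s) x)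
    (contDiff_const.mul (ContDiff.sum fun i _ => ContDiff.sum fun j _ =>
      ContDiff.pow (hv.curlM i j) 2))
    (fun s x => (HasDerivAt.fun_sum fun i _ => HasDerivAt.fun_sum fun j _ =>
      (hv.hasDerivAt_curlM i j s x).fun_pow 2).const_mul (1 / 2)) t
  have h3 := SpaceTimeSmooth.hasDerivAt_setIntegral hdom.bounded hΩ
    (f := fun s x => gradNormSq (divg (u s)) x)
    (ContDiff.sum fun i _ => ContDiff.pow (hu.divg.pd i) 2)
    (fun s x => HasDerivAt.fun_sum fun i _ => (hu.hasDerivAt_pd_divg i s x).fun_pow 2) t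
  have h4 := SpaceTimeSmooth.hasDerivAt_setIntegral hdom.bounded hΩ
    (f := fun s x => ∑ j, ccurl (u s) x j ^ 2)
    (ContDiff.sum fun j _ => ContDiff.pow (hu.ccurl j) 2)
    (fun s x => HasDerivAt.fun_sum fun j _ => (hu.hasDerivAt_ccurl j s x).fun_pow 2) t
  refine ⟨_, ((h1.add h2).add (h3.const_mul (2 * μ + lam))).add (h4.const_mul μ), ?_⟩
  have e1 : ∫ x in Ω, ((2 : ℕ) : ℝ) * divg (tder u t) x ^ (2 - 1) * divg (tder (tder u) t) x
      = 2 * ∫ x in Ω, divg (tder u t) x * divg (tder (tder u) t) x := by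
    rw [← integral_const_mul]
    congr 1 with x
    push_cast
    ring
  have e2 : ∫ x in Ω, (1 / 2) * ∑ i, ∑ j, ((2 : ℕ) : ℝ) * curlM (tder u t) x i j ^ (2 - 1)
        * curlM (tder (tder u) t) x i j
      = 2 * ∫ x in Ω, (1 / 2) * ∑ i, ∑ j,
        curlM (tder u t) x i j * curlM (tder (tder u) t) x i j := by
    rw [← integral_const_mul]
    congr 1 with x
    simp [mul_assoc, ← Finset.mul_sum]
  have e3 : ∫ x in Ω, ∑ i, ((2 : ℕ) : ℝ) * pd i (divg (u t)) x ^ (2 - 1)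
        * pd i (divg (tder u t)) x
      = 2 * ∫ x in Ω, ∑ j, pd j (divg (tder u t)) x * pd j (divg (u t)) x := by
    rw [← integral_const_mul]
    congr 1 with x
    rw [Finset.mul_sum]
    exact Finset.sum_congr rfl fun i _ => by push_cast; ring
  have e4 : ∫ x in Ω, ∑ j, ((2 : ℕ) : ℝ) * ccurl (u t) x j ^ (2 - 1) * ccurl (tder u t) x j
      = 2 * ∫ x in Ω, ∑ j, ccurl (tder u t) x j * ccurl (u t) x j := by
    rw [← integral_const_mul]
    congr 1 with x
    rw [Finset.mul_sum]
    exact Finset.sum_congr rfl fun i _ => by push_cast; ring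
  rw [e1, e2, e3, e4, hdiv, hcurl, htheta]
  ring
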